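/- arXiv:1304.7602 — 3 statements merged into one kernel-verified Lean document; each statement's English description precedes it below -/
import Mathlib

section
/- Reduction property of the Izergin determinant: let x̄, ȳ ∈ ℂⁿ and z ∈ ℂ, z ≠ 0, be such that the extended tuples (x₁,…,xₙ, zq⁻²) and (y₁,…,yₙ, z) are admissible (entries of each tuple pairwise distinct and every entry of the first tuple distinct from every entry of the second). Then K_{n+1}((x̄, zq⁻²)|(ȳ, z)) = −(q/z)·K_n(x̄|ȳ). -/
open Finset

/-- The function `f(u,v) = (qu - q⁻¹v)/(u - v)`. -/
noncomputable def fF (q u v : ℂ) : ℂ := (q * u - q⁻¹ * v) / (u - v)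

/-- The function `g(u,v) = (q - q⁻¹)/(u - v)`. -/
noncomputable def gF (q u v : ℂ) : ℂ := (q - q⁻¹) / (u - v)

/-- The Izergin determinant `K_n(x̄|ȳ)`. -/
noncomputable def Kiz (q : ℂ) {n : ℕ} (x y : Fin n → ℂ) : ℂ :=
  (∏ i : Fin n, ∏ j ∈ Finset.Ioi i, ((x i - x j) * (y j - y i)))⁻¹ *
    ∑ σ : Equiv.Perm (Fin n), ((Equiv.Perm.sign σ : ℤ) : ℂ) *
      ∏ i : Fin n,
        ((q - q⁻¹) / (x i - y (σ i)) *
          ∏ j ∈ Finset.univ.erase (σ i), (q * x i - q⁻¹ * y j))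

/-- The modified Izergin determinant `K^{(l)}_n(x̄|ȳ) = (∏ x_i)·K_n(x̄|ȳ)`. -/
noncomputable def Kl (q : ℂ) {n : ℕ} (x y : Fin n → ℂ) : ℂ := (∏ i, x i) * Kiz q x y

/-- The modified Izergin determinant `K^{(r)}_n(x̄|ȳ) = (∏ y_j)·K_n(x̄|ȳ)`. -/
noncomputable def Kr (q : ℂ) {n : ℕ} (x y : Fin n → ℂ) : ℂ := (∏ j, y j) * Kiz q x y

/-- The matrix whose determinant is the numerator of `Kiz`, with rows indexed by `y`. -/
noncomputable def izerginMatrix (q : ℂ) {n : ℕ} (x y : Fin n → ℂ) :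
    Matrix (Fin n) (Fin n) ℂ :=
  Matrix.of fun j i ↦ (q - q⁻¹) / (x i - y j) * ∏ k ∈ univ.erase j, (q * x i - q⁻¹ * y k)

theorem Kiz_eq_det (q : ℂ) {n : ℕ} (x y : Fin n → ℂ) :
    Kiz q x y = (∏ i : Fin n, ∏ j ∈ Ioi i, ((x i - x j) * (y j - y i)))⁻¹ *
      (izerginMatrix q x y).det := by
  simp only [Kiz, Matrix.det_apply', izerginMatrix, Matrix.of_apply]

theorem prod_Ioi_castSucc {M : Type*} [CommMonoid M] {n : ℕ} (i : Fin n) (f : Fin (n + 1) → M) :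
    ∏ j ∈ Ioi i.castSucc, f j = (∏ j ∈ Ioi i, f j.castSucc) * f (Fin.last n) := by
  simp only [← filter_lt_eq_Ioi, prod_filter, Fin.prod_univ_castSucc, Fin.castSucc_lt_castSucc_iff,
    Fin.castSucc_lt_last, if_true]

theorem prod_erase_castSucc {M : Type*} [CommMonoid M] {n : ℕ} (i : Fin n)
    (f : Fin (n + 1) → M) :
    ∏ j ∈ univ.erase i.castSucc, f j
      = (∏ j ∈ univ.erase i, f j.castSucc) * f (Fin.last n) := by
  simp only [← filter_ne', prod_filter, Fin.prod_univ_castSucc, ne_eq, Fin.castSucc_inj,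
    (Fin.castSucc_lt_last i).ne', not_false_eq_true, if_true]

theorem prod_erase_last {M : Type*} [CommMonoid M] {n : ℕ} (f : Fin (n + 1) → M) :
    ∏ j ∈ univ.erase (Fin.last n), f j = ∏ j : Fin n, f j.castSucc := by
  simp only [← filter_ne', prod_filter, Fin.prod_univ_castSucc, ne_eq,
    (Fin.castSucc_lt_last _).ne, not_false_eq_true, if_true, not_true_eq_false, if_false, mul_one]

theorem det_izerginMatrix_snoc (q : ℂ) {n : ℕ} (x y : Fin n → ℂ) (w z : ℂ)
    (h : q * w = q⁻¹ * z) :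
    (izerginMatrix q (Fin.snoc x w : Fin (n + 1) → ℂ) (Fin.snoc y z)).det =
      (q - q⁻¹) / (w - z) * (∏ j, (q * w - q⁻¹ * y j)) *
        ((∏ i, (q * x i - q⁻¹ * z)) * (izerginMatrix q x y).det) := by
  rw [Matrix.det_succ_column _ (Fin.last n), Fin.sum_univ_castSucc, sum_eq_zero, zero_add]
  · rw [← Matrix.det_mul_row]
    congr 1
    · simp [izerginMatrix, prod_erase_last]
    · congr 1
      ext j i
      simp [izerginMatrix, prod_erase_castSucc]
      ring
  · intro j _
    simp [izerginMatrix, prod_erase_castSucc, h]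

/-- Reduction property: `K_{n+1}((x̄, zq⁻²)|(ȳ, z)) = −(q/z)·K_n(x̄|ȳ)`. -/
theorem izergin_reduction_left (q : ℂ) (hq : q ≠ 0) (hq2 : q ^ 2 ≠ 1)
    (n : ℕ) (x y : Fin n → ℂ) (z : ℂ) (hz : z ≠ 0)
    (hx : Function.Injective (Fin.snoc x ((q ^ 2)⁻¹ * z) : Fin (n + 1) → ℂ))
    (hy : Function.Injective (Fin.snoc y z : Fin (n + 1) → ℂ))
    (hxy : ∀ i j, (Fin.snoc x ((q ^ 2)⁻¹ * z) : Fin (n + 1) → ℂ) i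
        ≠ (Fin.snoc y z : Fin (n + 1) → ℂ) j) :
    Kiz q (Fin.snoc x ((q ^ 2)⁻¹ * z)) (Fin.snoc y z) = -(q / z) * Kiz q x y := by
  rw [Kiz_eq_det, Kiz_eq_det, det_izerginMatrix_snoc q x y _ z (by field_simp)]
  have hzq : (q ^ 2)⁻¹ * z - z ≠ 0 := by
    simpa [sub_eq_zero] using hxy (Fin.last n) (Fin.last n)
  have hxw (i : Fin n) : x i - (q ^ 2)⁻¹ * z ≠ 0 := fun h ↦
    (Fin.castSucc_lt_last i).ne (hx (by simpa [sub_eq_zero] using h))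
  have hyz (i : Fin n) : z - y i ≠ 0 := fun h ↦
    (Fin.castSucc_lt_last i).ne' (hy (by simpa [sub_eq_zero] using h))
  have hg : (q - q⁻¹) / ((q ^ 2)⁻¹ * z - z) = -(q / z) := by
    rw [div_eq_iff hzq]
    field_simp
    ring
  have hcross : (∏ j, (q * ((q ^ 2)⁻¹ * z) - q⁻¹ * y j)) * ∏ i, (q * x i - q⁻¹ * z) =
      ∏ i, ((x i - (q ^ 2)⁻¹ * z) * (z - y i)) := by
    rw [← prod_mul_distrib]
    refine prod_congr rfl fun i _ ↦ ?_
    field_simp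
  have hne : ∏ i, ((x i - (q ^ 2)⁻¹ * z) * (z - y i)) ≠ 0 :=
    prod_ne_zero_iff.mpr fun i _ ↦ mul_ne_zero (hxw i) (hyz i)
  have hlast : Ioi (Fin.last n) = ∅ := Ioi_top
  simp only [Fin.prod_univ_castSucc, prod_Ioi_castSucc, Fin.snoc_castSucc, Fin.snoc_last, hlast,
    prod_empty, mul_one]
  rw [prod_mul_distrib, hg, mul_inv]
  calc _ = (∏ i : Fin n, ∏ j ∈ Ioi i, ((x i - x j) * (y j - y i)))⁻¹ *
        (∏ i, ((x i - (q ^ 2)⁻¹ * z) * (z - y i)))⁻¹ * (-(q / z)) *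
        ((∏ j, (q * ((q ^ 2)⁻¹ * z) - q⁻¹ * y j)) * ∏ i, (q * x i - q⁻¹ * z)) *
        (izerginMatrix q x y).det := by ring
    _ = _ := by
      rw [hcross]
      generalize ∏ i, ((x i - (q ^ 2)⁻¹ * z) * (z - y i)) = c at hne
      rw [mul_right_comm _ c⁻¹, inv_mul_cancel_right₀ hne]
      ring
end

section
/- Inverse order of arguments, first form: let x̄, ȳ ∈ ℂⁿ be admissible tuples (x_i pairwise distinct, y_j pairwise distinct, x_i ≠ y_j for all i,j) and suppose moreover that q⁻²x_i ≠ y_j for all i,j (so that K_n(q⁻²x̄|ȳ) is defined). Then f(ȳ,x̄)·K_n(q⁻²x̄|ȳ) = (−q)ⁿ·K_n(ȳ|x̄), where q⁻²x̄ = (q⁻²x₁,…,q⁻²xₙ) and f(ȳ,x̄) = ∏_{j,i} f(y_j,x_i). -/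
open Finset

/-- A power count over the pairs `i < j`, matched against `n - 1` factors for every `i`. -/
lemma prod_Ioi_inv_sq (a : ℂ) (n : ℕ) :
    (∏ i : Fin n, ∏ _j ∈ Finset.Ioi i, (a ^ 2)⁻¹) = ∏ _i : Fin n, (-a⁻¹) ^ (n - 1) := by
  have hcount : ∑ i : Fin n, (n - 1 - (i : ℕ)) = ∑ i ∈ Finset.range n, i := by
    rw [Fin.sum_univ_eq_sum_range (fun i => n - 1 - i) n]
    exact Finset.sum_range_reflect (fun i => i) n
  simp only [Finset.prod_const, Fin.card_Ioi, Finset.prod_pow_eq_pow_sum, hcount,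
    Finset.card_univ, Fintype.card_fin]
  rw [show (a ^ 2)⁻¹ = (-a⁻¹) ^ 2 by rw [neg_sq, inv_pow], ← pow_mul, ← pow_mul,
    mul_comm 2, Finset.sum_range_id_mul_two, mul_comm]

/-- The products over the pairs `(i, k)` with `k ≠ σ i`, taken in either order. -/
lemma prod_prod_erase_perm {n : ℕ} (σ : Equiv.Perm (Fin n)) (F : Fin n → Fin n → ℂ) :
    (∏ i, ∏ k ∈ Finset.univ.erase (σ i), F k i)
      = ∏ k, ∏ i ∈ Finset.univ.erase (σ⁻¹ k), F k i := by
  refine Finset.prod_comm' fun i k => ?_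
  simp only [Finset.mem_univ, Finset.mem_erase, true_and, and_true, ne_eq,
    Equiv.Perm.eq_inv_iff_eq, eq_comm]

/-- The factor of index `i` in the Leibniz expansion, before and after the inversion. -/
lemma prod_fF_mul_factor (q : ℂ) (hq : q ≠ 0) {n : ℕ} (u : ℂ) (y : Fin n → ℂ) (s : Fin n)
    (hu : ∀ j, u ≠ y j) (hu2 : ∀ j, (q ^ 2)⁻¹ * u ≠ y j) :
    (∏ j, fF q (y j) u) * ((q - q⁻¹) / ((q ^ 2)⁻¹ * u - y s) *
        ∏ k ∈ Finset.univ.erase s, (q * ((q ^ 2)⁻¹ * u) - q⁻¹ * y k))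
      = (-q * (-q⁻¹) ^ (n - 1)) * ((q - q⁻¹) / (y s - u) *
        ∏ k ∈ Finset.univ.erase s, (q * y k - q⁻¹ * u)) := by
  have hfactor : ∀ k, fF q (y k) u * (q * ((q ^ 2)⁻¹ * u) - q⁻¹ * y k)
      = -q⁻¹ * (q * y k - q⁻¹ * u) := fun k => by
    have h := sub_ne_zero.mpr (hu k).symm
    unfold fF
    field_simp
    ring
  have hs : fF q (y s) u * ((q - q⁻¹) / ((q ^ 2)⁻¹ * u - y s))
      = -q * ((q - q⁻¹) / (y s - u)) := by
    have h := sub_ne_zero.mpr (hu s).symm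
    have h2 := sub_ne_zero.mpr (hu2 s)
    have hnum : q * y s - q⁻¹ * u = -q * ((q ^ 2)⁻¹ * u - y s) := by
      field_simp
      ring
    rw [fF, hnum, div_mul_div_comm, mul_right_comm, mul_div_mul_right _ _ h2, mul_div_assoc]
  have hprod : (∏ k ∈ Finset.univ.erase s, fF q (y k) u) *
      ∏ k ∈ Finset.univ.erase s, (q * ((q ^ 2)⁻¹ * u) - q⁻¹ * y k)
      = (-q⁻¹) ^ (n - 1) * ∏ k ∈ Finset.univ.erase s, (q * y k - q⁻¹ * u) := by
    rw [← Finset.prod_mul_distrib, Finset.prod_congr rfl fun k _ => hfactor k,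
      Finset.prod_mul_distrib, Finset.prod_const, Finset.card_erase_of_mem (Finset.mem_univ s),
      Finset.card_univ, Fintype.card_fin]
  rw [← Finset.mul_prod_erase Finset.univ (fun j => fF q (y j) u) (Finset.mem_univ s),
    mul_mul_mul_comm, hs, hprod]
  ring

/-- Inverse order of arguments, first form:
`f(ȳ,x̄)·K_n(q⁻²x̄|ȳ) = (−q)ⁿ·K_n(ȳ|x̄)`. -/
theorem izergin_inverse_order_left (q : ℂ) (hq : q ≠ 0) (hq2 : q ^ 2 ≠ 1)
    (n : ℕ) (x y : Fin n → ℂ)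
    (hx : Function.Injective x) (hy : Function.Injective y)
    (hxy : ∀ i j, x i ≠ y j)
    (hxy2 : ∀ i j, (q ^ 2)⁻¹ * x i ≠ y j) :
    (∏ j, ∏ i, fF q (y j) (x i)) * Kiz q (fun i => (q ^ 2)⁻¹ * x i) y
      = (-q) ^ n * Kiz q y x := by
  have hprefactor : (∏ i : Fin n, ∏ j ∈ Finset.Ioi i,
        (((q ^ 2)⁻¹ * x i - (q ^ 2)⁻¹ * x j) * (y j - y i)))
      = (∏ _i : Fin n, (-q⁻¹) ^ (n - 1)) *
        ∏ i : Fin n, ∏ j ∈ Finset.Ioi i, ((y i - y j) * (x j - x i)) := by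
    rw [← prod_Ioi_inv_sq]
    simp only [← Finset.prod_mul_distrib]
    refine Finset.prod_congr rfl fun i _ => Finset.prod_congr rfl fun j _ => ?_
    ring
  have hne : (∏ _i : Fin n, (-q⁻¹) ^ (n - 1)) ≠ 0 :=
    Finset.prod_ne_zero_iff.mpr fun _ _ => pow_ne_zero _ (neg_ne_zero.mpr (inv_ne_zero hq))
  have hterm : ∀ σ : Equiv.Perm (Fin n),
      (∏ j, ∏ i, fF q (y j) (x i)) * ∏ i : Fin n,
        ((q - q⁻¹) / ((q ^ 2)⁻¹ * x i - y (σ i)) *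
          ∏ j ∈ Finset.univ.erase (σ i), (q * ((q ^ 2)⁻¹ * x i) - q⁻¹ * y j))
      = ((-q) ^ n * ∏ _i : Fin n, (-q⁻¹) ^ (n - 1)) * ∏ i : Fin n,
        ((q - q⁻¹) / (y i - x (σ⁻¹ i)) *
          ∏ j ∈ Finset.univ.erase (σ⁻¹ i), (q * y i - q⁻¹ * x j)) := fun σ => by
    rw [Finset.prod_comm, ← Finset.prod_mul_distrib,
      Finset.prod_congr rfl fun i _ =>
        prod_fF_mul_factor q hq (x i) y (σ i) (hxy i) (hxy2 i)]
    simp only [Finset.prod_mul_distrib]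
    rw [prod_prod_erase_perm σ fun k i => q * y k - q⁻¹ * x i,
      ← Equiv.prod_comp σ fun k => (q - q⁻¹) / (y k - x (σ⁻¹ k))]
    simp
  have hsum : (∏ j, ∏ i, fF q (y j) (x i)) *
      (∑ σ : Equiv.Perm (Fin n), ((Equiv.Perm.sign σ : ℤ) : ℂ) * ∏ i : Fin n,
        ((q - q⁻¹) / ((q ^ 2)⁻¹ * x i - y (σ i)) *
          ∏ j ∈ Finset.univ.erase (σ i), (q * ((q ^ 2)⁻¹ * x i) - q⁻¹ * y j)))
      = ((-q) ^ n * ∏ _i : Fin n, (-q⁻¹) ^ (n - 1)) *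
      ∑ σ : Equiv.Perm (Fin n), ((Equiv.Perm.sign σ : ℤ) : ℂ) * ∏ i : Fin n,
        ((q - q⁻¹) / (y i - x (σ i)) *
          ∏ j ∈ Finset.univ.erase (σ i), (q * y i - q⁻¹ * x j)) := by
    rw [Finset.mul_sum, Finset.mul_sum]
    refine Fintype.sum_equiv (Equiv.inv _) _ _ fun σ => ?_
    rw [mul_left_comm, hterm σ, mul_left_comm, Equiv.inv_apply, Equiv.Perm.sign_inv]
  unfold Kiz
  rw [mul_left_comm, hsum, hprefactor]
  generalize (∏ _i : Fin n, (-q⁻¹) ^ (n - 1)) = c at hne ⊢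
  rw [mul_inv, mul_comm ((-q) ^ n) c, mul_assoc c, mul_comm c⁻¹, mul_assoc,
    inv_mul_cancel_left₀ hne, mul_left_comm]
end

section
/- Inverse order of arguments, second form: let x̄, ȳ ∈ ℂⁿ be admissible tuples (x_i pairwise distinct, y_j pairwise distinct, x_i ≠ y_j for all i,j) and suppose moreover that x_i ≠ q²y_j for all i,j (so that K_n(x̄|q²ȳ) is defined). Then f(ȳ,x̄)·K_n(x̄|q²ȳ) = (−q)^{−n}·K_n(ȳ|x̄), where q²ȳ = (q²y₁,…,q²yₙ) and f(ȳ,x̄) = ∏_{j,i} f(y_j,x_i). -/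
open Finset

/-- A complement product attached to a permutation may be read along rows or along columns. -/
theorem sum_sign_mul_prod_erase_swap {n : ℕ} (a h : Fin n → Fin n → ℂ) :
    ∑ σ : Equiv.Perm (Fin n), ((Equiv.Perm.sign σ : ℤ) : ℂ) *
        ∏ i, (a (σ i) i * ∏ j ∈ univ.erase (σ i), h j i) =
      ∑ σ : Equiv.Perm (Fin n), ((Equiv.Perm.sign σ : ℤ) : ℂ) *
        ∏ i, (a i (σ i) * ∏ j ∈ univ.erase (σ i), h i j) := by
  rw [← Equiv.sum_comp (Equiv.inv (Equiv.Perm (Fin n)))]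
  refine Finset.sum_congr rfl fun σ _ => ?_
  rw [Equiv.inv_apply, Equiv.Perm.sign_inv, Finset.prod_mul_distrib, Finset.prod_mul_distrib]
  congr 2
  · rw [← Equiv.prod_comp σ]
    simp
  · refine Finset.prod_comm' fun i j => ?_
    simp only [mem_univ, mem_erase, ne_eq, and_true, true_and, Equiv.Perm.eq_inv_iff_eq]
    exact not_congr eq_comm

theorem prod_prod_Ioi_sq {n : ℕ} (c : ℂ) :
    ∏ i : Fin n, ∏ _j ∈ Finset.Ioi i, c ^ 2 = (c ^ (n - 1)) ^ n := by
  simp only [Finset.prod_const, Fin.card_Ioi, ← pow_mul]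
  rw [Finset.prod_pow_eq_pow_sum]
  congr 1
  rw [← Finset.mul_sum, Fin.sum_univ_eq_sum_range (fun i => n - 1 - i) n,
    Finset.sum_range_reflect (fun i => i) n, mul_comm, Finset.sum_range_id_mul_two, mul_comm]

theorem prod_fF_mul_row {q : ℂ} (hq : q ≠ 0) {n : ℕ} (u : ℂ) (y : Fin n → ℂ)
    (h1 : ∀ j, u ≠ y j) (h2 : ∀ j, u ≠ q ^ 2 * y j) (k : Fin n) :
    (∏ j, fF q (y j) u) * ((q - q⁻¹) / (u - q ^ 2 * y k) *
        ∏ j ∈ univ.erase k, (q * u - q⁻¹ * (q ^ 2 * y j))) =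
      (-q)⁻¹ * (-q) ^ (n - 1) *
        ((q - q⁻¹) / (y k - u) * ∏ j ∈ univ.erase k, (q * y j - q⁻¹ * u)) := by
  have hk : fF q (y k) u * ((q - q⁻¹) / (u - q ^ 2 * y k)) =
      (-q)⁻¹ * ((q - q⁻¹) / (y k - u)) := by
    have e1 : y k - u ≠ 0 := sub_ne_zero.2 (h1 k).symm
    have e2 : u - q ^ 2 * y k ≠ 0 := sub_ne_zero.2 (h2 k)
    have e3 : q * y k - q⁻¹ * u = -q⁻¹ * (u - q ^ 2 * y k) := by
      field_simp
      ring
    rw [fF, e3, inv_neg]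
    field_simp
  have he : (∏ j ∈ univ.erase k, fF q (y j) u) *
      ∏ j ∈ univ.erase k, (q * u - q⁻¹ * (q ^ 2 * y j)) =
      (-q) ^ (n - 1) * ∏ j ∈ univ.erase k, (q * y j - q⁻¹ * u) := by
    have hc : (-q) ^ (n - 1) = ∏ _j ∈ univ.erase k, (-q) := by
      simp [Finset.prod_const, Finset.card_erase_of_mem]
    rw [hc, ← Finset.prod_mul_distrib, ← Finset.prod_mul_distrib]
    refine Finset.prod_congr rfl fun j _ => ?_
    have e1 : y j - u ≠ 0 := sub_ne_zero.2 (h1 j).symm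
    have e3 : q * u - q⁻¹ * (q ^ 2 * y j) = -q * (y j - u) := by
      field_simp
      ring
    rw [fF, e3]
    field_simp
  rw [← Finset.mul_prod_erase univ (fun j => fF q (y j) u) (mem_univ k)]
  linear_combination (∏ j ∈ univ.erase k, fF q (y j) u) *
    (∏ j ∈ univ.erase k, (q * u - q⁻¹ * (q ^ 2 * y j))) * hk +
    (-q)⁻¹ * ((q - q⁻¹) / (y k - u)) * he

/-- Inverse order of arguments, second form:
`f(ȳ,x̄)·K_n(x̄|q²ȳ) = (−q)^{−n}·K_n(ȳ|x̄)`. -/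
theorem izergin_inverse_order_right (q : ℂ) (hq : q ≠ 0) (hq2 : q ^ 2 ≠ 1)
    (n : ℕ) (x y : Fin n → ℂ)
    (hx : Function.Injective x) (hy : Function.Injective y)
    (hxy : ∀ i j, x i ≠ y j)
    (hxy2 : ∀ i j, x i ≠ q ^ 2 * y j) :
    (∏ j, ∏ i, fF q (y j) (x i)) * Kiz q x (fun j => q ^ 2 * y j)
      = (-q) ^ (-(n : ℤ)) * Kiz q y x := by
  have hpre : ∏ i : Fin n, ∏ j ∈ Finset.Ioi i,
      ((x i - x j) * (q ^ 2 * y j - q ^ 2 * y i)) =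
      ((-q) ^ (n - 1)) ^ n *
        ∏ i : Fin n, ∏ j ∈ Finset.Ioi i, ((y i - y j) * (x j - x i)) := by
    rw [← prod_prod_Ioi_sq, ← Finset.prod_mul_distrib]
    refine Finset.prod_congr rfl fun i _ => ?_
    rw [← Finset.prod_mul_distrib]
    exact Finset.prod_congr rfl fun j _ => by ring
  have hC : ((-q) ^ (n - 1)) ^ n ≠ 0 := pow_ne_zero _ (pow_ne_zero _ (neg_ne_zero.2 hq))
  have hsum : (∏ j, ∏ i, fF q (y j) (x i)) *
      ∑ σ : Equiv.Perm (Fin n), ((Equiv.Perm.sign σ : ℤ) : ℂ) *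
        ∏ i, ((q - q⁻¹) / (x i - q ^ 2 * y (σ i)) *
          ∏ j ∈ univ.erase (σ i), (q * x i - q⁻¹ * (q ^ 2 * y j))) =
      ((-q)⁻¹) ^ n * ((-q) ^ (n - 1)) ^ n *
      ∑ σ : Equiv.Perm (Fin n), ((Equiv.Perm.sign σ : ℤ) : ℂ) *
        ∏ i, ((q - q⁻¹) / (y i - x (σ i)) *
          ∏ j ∈ univ.erase (σ i), (q * y i - q⁻¹ * x j)) := by
    rw [← sum_sign_mul_prod_erase_swap (fun i j => (q - q⁻¹) / (y i - x j))
      (fun i j => q * y i - q⁻¹ * x j), Finset.mul_sum, Finset.mul_sum, Finset.prod_comm]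
    refine Finset.sum_congr rfl fun σ _ => ?_
    rw [mul_left_comm, ← Finset.prod_mul_distrib,
      Finset.prod_congr rfl fun i _ => prod_fF_mul_row hq (x i) y (hxy i) (hxy2 i) (σ i),
      Finset.prod_mul_distrib, Finset.prod_const, card_univ, Fintype.card_fin, mul_pow]
    ring
  unfold Kiz
  rw [hpre, mul_left_comm, hsum, zpow_neg, zpow_natCast, mul_inv, inv_pow]
  field_simp
end
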